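/- arXiv:1512.00380 — 2 statements merged into one kernel-verified Lean document; each statement's English description precedes it below -/
import Mathlib

section
/- There exists a Baire class 1 function f : [0,1] → ℝ with L_f = T if and only if: T is closed, the set C = {x ∈ [0,1] : T(x) = ∅} is countable, and the set D = {x : the vertical section of the closure of T in [0,1] × [-∞,∞] at x has more than one element} is meager in [0,1]. -/
open Set Filter Topology Metric

noncomputable section

/-- The graph of `f` restricted to the set `A`, as a subset of `ℝ × ℝ`. -/
def graphOn (A : Set ℝ) (f : ℝ → ℝ) : Set (ℝ × ℝ) :=
  {p : ℝ × ℝ | p.1 ∈ A ∧ p.2 = f p.1}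

/-- The set of accumulation points of a set `G ⊆ ℝ × ℝ`. -/
def accPts (G : Set (ℝ × ℝ)) : Set (ℝ × ℝ) :=
  {p : ℝ × ℝ | AccPt p (𝓟 G)}

/-- Baire class 1 on `[0,1]`: pointwise limit of continuous functions. -/
def Baire1 (f : ℝ → ℝ) : Prop :=
  ∃ g : ℕ → ℝ → ℝ, (∀ n, ContinuousOn (g n) (Icc 0 1)) ∧
    ∀ x ∈ Icc (0:ℝ) 1, Tendsto (fun n => g n x) atTop (𝓝 (f x))

/-- Baire class 2 on `[0,1]`: pointwise limit of Baire class 1 functions. -/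
def Baire2 (f : ℝ → ℝ) : Prop :=
  ∃ g : ℕ → ℝ → ℝ, (∀ n, Baire1 (g n)) ∧
    ∀ x ∈ Icc (0:ℝ) 1, Tendsto (fun n => g n x) atTop (𝓝 (f x))

/-- A set is meager relative to the subspace `[0,1]`. -/
def MeagreIn01 (D : Set ℝ) : Prop :=
  IsMeagre ((↑) ⁻¹' D : Set (Icc (0:ℝ) 1))

/-- Embedding of the plane into `ℝ × ℝ̄` (extended reals in the second coordinate). -/
def embedE (p : ℝ × ℝ) : ℝ × EReal := (p.1, (p.2 : EReal))

lemma baire1_of_locally {f : ℝ → ℝ}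
    (h : ∀ ε > 0, ∃ H : ℕ → Set ℝ, (∀ n, IsClosed (H n)) ∧
      (∀ x ∈ Icc (0:ℝ) 1, ∀ᶠ n in atTop, x ∈ H n) ∧
      ∀ n, ∀ x ∈ H n, ∀ᶠ y in 𝓝 x, y ∈ H n → |f x - f y| < ε) : Baire1 f := by
  have hpos : ∀ r : ℕ, (0:ℝ) < 1 / ((r:ℝ) + 1) := fun r => Nat.one_div_pos_of_nat
  choose H hclosed hev hosc using fun r : ℕ => h _ (hpos r)
  have key : ∀ n : ℕ, ∃ g : C(ℝ, ℝ), ∀ y, ∀ r ≤ n, y ∈ H r n →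
      |g y - f y| < 1 / ((r:ℝ) + 1) := by
    intro n
    refine exists_continuous_forall_mem_convex_of_local_const
      (t := fun y => {z : ℝ | ∀ r ≤ n, y ∈ H r n → |z - f y| < 1 / ((r:ℝ) + 1)}) ?_ ?_
    · intro y
      have : {z : ℝ | ∀ r ≤ n, y ∈ H r n → |z - f y| < 1 / ((r:ℝ) + 1)} =
          ⋂ r : ℕ, ⋂ _ : r ≤ n, ⋂ _ : y ∈ H r n, ball (f y) (1 / ((r:ℝ) + 1)) := by
        ext z
        simp [Real.dist_eq]
      rw [this]
      exact convex_iInter fun r => convex_iInter fun _ => convex_iInter fun _ => convex_ball _ _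
    · intro x
      refine ⟨f x, ?_⟩
      have : ∀ r ∈ Iic n, ∀ᶠ y in 𝓝 x, y ∈ H r n → |f x - f y| < 1 / ((r:ℝ) + 1) := by
        intro r _
        by_cases hx : x ∈ H r n
        · exact hosc r n x hx
        · filter_upwards [(hclosed r n).isOpen_compl.mem_nhds hx] with y hy hy'
          exact absurd hy' hy
      exact (eventually_all_finite (finite_Iic n)).2 this
  choose g hg using key
  refine ⟨fun n => g n, fun n => (g n).continuous.continuousOn, fun x hx => ?_⟩
  rw [Metric.tendsto_atTop']
  intro ε hε
  obtain ⟨r, hr⟩ := exists_nat_one_div_lt hε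
  obtain ⟨N, hN⟩ := eventually_atTop.1 (hev r x hx)
  refine ⟨max N r, fun n hn => ?_⟩
  rw [Real.dist_eq]
  exact (hg n x r (le_trans (le_max_right _ _) hn.le)
    (hN n (le_trans (le_max_left _ _) hn.le))).trans hr

lemma baire1_of_closed_cover {f : ℝ → ℝ}
    (h : ∀ ε > 0, ∃ A : ℕ → Set ℝ, (∀ n, IsClosed (A n)) ∧ Icc (0:ℝ) 1 ⊆ ⋃ n, A n ∧
      ∀ n, ∀ x ∈ A n, ∀ y ∈ A n, |f x - f y| < ε) : Baire1 f := by
  refine baire1_of_locally fun ε hε => ?_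
  obtain ⟨A, hA, hcov, hosc⟩ := h ε hε
  refine ⟨fun n => ⋃ j ∈ Iic n,
    A j ∩ ⋂ i, ⋂ _ : i < j, ⋂ z ∈ A i, {x | 1 / ((n:ℝ) + 1) ≤ dist x z}, fun n => ?_, ?_, ?_⟩
  · refine (finite_Iic n).isClosed_biUnion fun j _ => (hA j).inter ?_
    exact isClosed_iInter fun i => isClosed_iInter fun _ => isClosed_biInter fun z _ =>
      isClosed_le continuous_const (by fun_prop)
  · intro x hx
    classical
    have hex : ∃ j, x ∈ A j := mem_iUnion.1 (hcov hx)
    have hsep : ∀ i ∈ Iio (Nat.find hex), ∀ᶠ n : ℕ in atTop,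
        ∀ z ∈ A i, 1 / ((n:ℝ) + 1) ≤ dist x z := by
      intro i hi
      obtain ⟨δ, hδ, hball⟩ :=
        Metric.isOpen_iff.1 (hA i).isOpen_compl x (Nat.find_min hex hi)
      filter_upwards [tendsto_one_div_add_atTop_nhds_zero_nat.eventually (gt_mem_nhds hδ)]
        with n hn z hz
      by_contra! hlt
      exact hball (mem_ball'.2 (hlt.trans hn)) hz
    filter_upwards [(eventually_all_finite (finite_Iio _)).2 hsep,
      eventually_ge_atTop (Nat.find hex)] with n hn hjn
    simp only [mem_iUnion, mem_inter_iff, mem_iInter, mem_ofPred_eq]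
    exact ⟨_, hjn, Nat.find_spec hex, fun i hi z hz => hn i hi z hz⟩
  · intro n x hx
    filter_upwards [Metric.ball_mem_nhds x (Nat.one_div_pos_of_nat (α := ℝ) (n := n))] with y hxy hy
    rw [mem_ball] at hxy
    simp only [mem_iUnion, mem_inter_iff, mem_iInter, mem_ofPred_eq] at hx hy
    obtain ⟨j, -, hxj, hxs⟩ := hx
    obtain ⟨i, -, hyi, hys⟩ := hy
    rcases lt_trichotomy i j with hij | rfl | hij
    · have := hxs i hij y hyi
      rw [dist_comm] at this
      linarith
    · exact hosc i x hxj y hyi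
    · have := hys j hij x hxj
      linarith

lemma baire1_of_Fσ_cover {f : ℝ → ℝ}
    (h : ∀ ε > 0, ∃ 𝒜 : Set (Set ℝ), 𝒜.Countable ∧ (∀ A ∈ 𝒜, IsGδ Aᶜ) ∧
      Icc (0:ℝ) 1 ⊆ ⋃₀ 𝒜 ∧ ∀ A ∈ 𝒜, ∀ x ∈ A, ∀ y ∈ A, |f x - f y| < ε) : Baire1 f := by
  refine baire1_of_closed_cover fun ε hε => ?_
  obtain ⟨𝒜, hcount, hG, hcov, hosc⟩ := h ε hε
  choose U hU hAU using fun A : 𝒜 => isGδ_iff_eq_iInter_nat.1 (hG A A.2)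
  have hmem : ∀ (A : 𝒜) x, x ∈ (A : Set ℝ) ↔ ∃ n, x ∉ U A n := by
    intro A x
    rw [← not_iff_not, ← mem_compl_iff, hAU A]
    simp
  have : Countable 𝒜 := hcount.to_subtype
  obtain ⟨A₀, hA₀, -⟩ := hcov (left_mem_Icc.2 zero_le_one)
  have : Nonempty (𝒜 × ℕ) := ⟨(⟨A₀, hA₀⟩, 0)⟩
  obtain ⟨φ, hφ⟩ := exists_surjective_nat (𝒜 × ℕ)
  refine ⟨fun n => (U (φ n).1 (φ n).2)ᶜ, fun n => (hU _ _).isClosed_compl, ?_, ?_⟩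
  · intro x hx
    obtain ⟨A, hA, hxA⟩ := hcov hx
    obtain ⟨m, hm⟩ := (hmem ⟨A, hA⟩ x).1 hxA
    obtain ⟨n, hn⟩ := hφ (⟨A, hA⟩, m)
    exact mem_iUnion.2 ⟨n, by simpa [hn] using hm⟩
  · intro n x hx y hy
    exact hosc _ (φ n).1.2 x ((hmem _ _).2 ⟨_, hx⟩) y ((hmem _ _).2 ⟨_, hy⟩)

/-- A Baire class 1 function oscillates arbitrarily little near the points of a residual set. -/
lemma Baire1.eventually_residual {f : ℝ → ℝ} (hf : Baire1 f) {ε : ℝ} (hε : 0 < ε) :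
    ∀ᶠ x : Icc (0:ℝ) 1 in residual _, ∀ᶠ y : Icc (0:ℝ) 1 in 𝓝 x, |f y - f x| < ε := by
  obtain ⟨g, hgc, hg⟩ := hf
  have hc : ∀ n, Continuous fun x : Icc (0:ℝ) 1 => g n x := fun n => (hgc n).domRestrict
  let F : ℕ → Set (Icc (0:ℝ) 1) := fun N => {x | ∀ n, N ≤ n → |g n x - g N x| ≤ ε / 4}
  have hF : ∀ N, IsClosed (F N) := by
    intro N
    simp only [F, ofPred_forall]
    exact isClosed_iInter fun n => isClosed_iInter fun _ =>
      isClosed_le ((hc n).sub (hc N)).abs continuous_const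
  have hcov : ⋃ N, F N = univ := by
    refine eq_univ_of_forall fun x => ?_
    obtain ⟨N, hN⟩ := Metric.cauchySeq_iff'.1 (hg x x.2).cauchySeq (ε / 4) (by positivity)
    exact mem_iUnion.2 ⟨N, fun n hn => (hN n hn).le⟩
  have hd := dense_iUnion_interior_of_closed hF hcov
  filter_upwards [residual_of_dense_open (isOpen_iUnion fun N => isOpen_interior) hd] with x hx
  obtain ⟨N, hN⟩ := mem_iUnion.1 hx
  have hlim : ∀ y ∈ F N, |f y - g N y| ≤ ε / 4 := fun y hy =>
    le_of_tendsto ((hg y y.2).sub_const _).abs (eventually_atTop.2 ⟨N, fun n hn => hy n hn⟩)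
  filter_upwards [isOpen_interior.mem_nhds hN,
    Metric.tendsto_nhds.1 ((hc N).tendsto x) (ε / 4) (by positivity)] with y hy hy'
  have h1 := abs_le.1 (hlim y (interior_subset hy))
  have h2 := abs_le.1 (hlim x (interior_subset hN))
  rw [Real.dist_eq] at hy'
  have h3 := abs_lt.1 hy'
  rw [abs_lt]
  constructor <;> linarith [h1.1, h1.2, h2.1, h2.2, h3.1, h3.2]

lemma isClosed_accPts (G : Set (ℝ × ℝ)) : IsClosed (accPts G) := isClosed_derivedSet G

lemma countable_empty_fibers (f : ℝ → ℝ) :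
    {x ∈ Icc (0:ℝ) 1 | ∀ y : ℝ, (x, y) ∉ accPts (graphOn (Icc 0 1) f)}.Countable := by
  set C := {x ∈ Icc (0:ℝ) 1 | ∀ y : ℝ, (x, y) ∉ accPts (graphOn (Icc 0 1) f)}
  have hun : C ⊆ ⋃ n : ℕ, {x ∈ C | |f x| ≤ n} := fun x hx => by
    obtain ⟨n, hn⟩ := exists_nat_ge |f x|
    exact mem_iUnion.2 ⟨n, hx, hn⟩
  refine (countable_iUnion fun n => ?_).mono hun
  have hdisc : DiscreteTopology {x ∈ C | |f x| ≤ n} := by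
    refine discreteTopology_of_noAccPts fun x hx hacc => ?_
    have := frequently_iff_neBot.1 (accPt_iff_frequently.1 hacc)
    obtain ⟨𝒰, h𝒰le⟩ := Ultrafilter.exists_le (𝓝 x ⊓ 𝓟 {y | y ≠ x ∧ y ∈ {x ∈ C | |f x| ≤ n}})
    obtain ⟨h𝒰, hle⟩ := le_inf_iff.1 h𝒰le
    rw [le_principal_iff] at hle
    have hK : (𝒰.map f : Filter ℝ) ≤ 𝓟 (Icc (-n : ℝ) n) := by
      rw [le_principal_iff, Ultrafilter.coe_map, mem_map]
      filter_upwards [hle] with y hy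
      exact abs_le.1 hy.2.2
    obtain ⟨z, -, hz⟩ := isCompact_Icc.ultrafilter_le_nhds _ hK
    refine hx.1.2 z ?_
    have htend : Tendsto (fun y => (y, f y)) 𝒰 (𝓝 (x, z)) :=
      (show Tendsto id (𝒰 : Filter ℝ) (𝓝 x) from h𝒰).prodMk_nhds hz
    refine accPt_iff_frequently.2 (htend.frequently (Eventually.frequently ?_))
    filter_upwards [hle] with y hy
    exact ⟨fun h => hy.1 (congrArg Prod.fst h), hy.2.1.1, rfl⟩
  exact countable_of_Lindelof_of_discrete

lemma Baire1.meagreIn01 {f : ℝ → ℝ} (hf : Baire1 f) {T : Set (ℝ × ℝ)}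
    (hfT : accPts (graphOn (Icc 0 1) f) = T) :
    MeagreIn01 {x : ℝ | ∃ y z : EReal,
      (x, y) ∈ closure (embedE '' T) ∧ (x, z) ∈ closure (embedE '' T) ∧ y ≠ z} := by
  have hres := eventually_countable_forall.2 fun n : ℕ =>
    hf.eventually_residual (Nat.one_div_pos_of_nat (α := ℝ) (n := n))
  unfold MeagreIn01 IsMeagre
  filter_upwards [hres] with x hx
  have hbd : ∀ n : ℕ, ∀ w : EReal, (x.1, w) ∈ closure (embedE '' T) →
      w ∈ Icc ((f x - 1 / (n + 1) : ℝ) : EReal) ((f x + 1 / (n + 1) : ℝ) : EReal) := by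
    intro n w hw
    have hx' : ∀ᶠ y in 𝓝 x.1, y ∈ Icc (0:ℝ) 1 → |f y - f x| < 1 / ((n:ℝ) + 1) := by
      have := hx n
      rw [nhds_subtype_eq_comap, eventually_comap] at this
      filter_upwards [this] with y hy hy01 using hy ⟨y, hy01⟩ rfl
    obtain ⟨V, hV, hVo, hxV⟩ := _root_.eventually_nhds_iff.1 hx'
    have hsub : closure (embedE '' T) ∩ (V ×ˢ univ) ⊆
        closure (univ ×ˢ Icc ((f x - 1 / (n + 1) : ℝ) : EReal) ((f x + 1 / (n + 1) : ℝ))) := by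
      rw [inter_comm]
      refine ((hVo.prod isOpen_univ).inter_closure).trans (closure_mono ?_)
      rintro _ ⟨⟨hpV, -⟩, ⟨a, b⟩, hab, rfl⟩
      refine ⟨mem_univ _, ?_⟩
      have hcl : (a, b) ∈ V ×ˢ univ ∩ closure (graphOn (Icc 0 1) f) := by
        refine ⟨⟨hpV, mem_univ _⟩, ?_⟩
        rw [← hfT] at hab
        exact derivedSet_subset_closure _ hab
      have hcl' := (hVo.prod isOpen_univ).inter_closure hcl
      have : closure (V ×ˢ univ ∩ graphOn (Icc 0 1) f) ⊆
          univ ×ˢ Icc (f x - 1 / (n + 1)) (f x + 1 / (n + 1)) := by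
        refine closure_minimal ?_ (isClosed_univ.prod isClosed_Icc)
        rintro ⟨c, d⟩ ⟨⟨hcV, -⟩, hc, hd⟩
        obtain rfl : d = f c := hd
        have := abs_lt.1 (hV c hcV hc)
        exact ⟨mem_univ _, by simp only; linarith [this.1], by simp only; linarith [this.2]⟩
      have := (this hcl').2
      exact ⟨EReal.coe_le_coe_iff.2 this.1, EReal.coe_le_coe_iff.2 this.2⟩
    rw [(isClosed_univ.prod isClosed_Icc).closure_eq] at hsub
    exact (hsub ⟨hw, hxV, mem_univ _⟩).2
  have heq : ∀ w : EReal, (x.1, w) ∈ closure (embedE '' T) → w = f x := by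
    intro w hw
    have hlim := tendsto_one_div_add_atTop_nhds_zero_nat (𝕜 := ℝ)
    refine le_antisymm ?_ ?_
    · refine ge_of_tendsto' (x := atTop) (f := fun n : ℕ => ((f x + 1 / (n + 1) : ℝ) : EReal)) ?_
        fun n => (hbd n w hw).2
      refine (continuous_coe_real_ereal.tendsto (f x)).comp ?_
      simpa using hlim.const_add (f x)
    · refine le_of_tendsto' (x := atTop) (f := fun n : ℕ => ((f x - 1 / (n + 1) : ℝ) : EReal)) ?_
        fun n => (hbd n w hw).1
      refine (continuous_coe_real_ereal.tendsto (f x)).comp ?_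
      simpa using hlim.const_sub (f x)
  rintro ⟨y, z, hy, hz, hne⟩
  exact hne ((heq y hy).trans (heq z hz).symm)

lemma eventually_fiber_close {T : Set (ℝ × ℝ)} {x η ε : ℝ} (hx : (x, η) ∈ T)
    (huniq : ¬ ∃ y z : EReal,
      (x, y) ∈ closure (embedE '' T) ∧ (x, z) ∈ closure (embedE '' T) ∧ y ≠ z) (hε : 0 < ε) :
    ∀ᶠ y in 𝓝 x, ∀ z : ℝ, (y, z) ∈ T → |z - η| < ε := by
  set K : Set EReal := (Ioo ((η - ε : ℝ) : EReal) ((η + ε : ℝ) : EReal))ᶜ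
  have hKc : IsCompact K := isOpen_Ioo.isClosed_compl.isCompact
  have hev : ∀ᶠ y in 𝓝 x, ∀ w ∈ K, (y, w) ∉ closure (embedE '' T) := by
    refine hKc.eventually_forall_of_forall_eventually
      (P := fun y w => (y, w) ∉ closure (embedE '' T)) fun w hw => ?_
    refine isClosed_closure.isOpen_compl.mem_nhds fun hmem => huniq
      ⟨w, η, hmem, subset_closure ⟨_, hx, rfl⟩, ?_⟩
    rintro rfl
    exact hw ⟨EReal.coe_lt_coe_iff.2 (by linarith), EReal.coe_lt_coe_iff.2 (by linarith)⟩
  filter_upwards [hev] with y hy z hz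
  by_contra hlt
  refine hy z (fun hmem => hlt ?_) (subset_closure ⟨_, hz, rfl⟩)
  have h1 := EReal.coe_lt_coe_iff.1 hmem.1
  have h2 := EReal.coe_lt_coe_iff.1 hmem.2
  rw [abs_lt]
  constructor <;> linarith

lemma exists_selection {T : Set (ℝ × ℝ)} (hT : IsClosed T) :
    ∃ (s : ℝ → ℝ) (k : ℝ → ℕ), ∀ x, (∃ y, (x, y) ∈ T) → (x, s x) ∈ T ∧ |s x| ≤ k x ∧
      (∀ y, (x, y) ∈ T → |y| ≤ k x → y ≤ s x) ∧ ∀ y, (x, y) ∈ T → (k x : ℝ) - 1 < |y| := by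
  classical
  have h : ∀ x, ∃ (s : ℝ) (k : ℕ), (∃ y, (x, y) ∈ T) → (x, s) ∈ T ∧ |s| ≤ k ∧
      (∀ y, (x, y) ∈ T → |y| ≤ k → y ≤ s) ∧ ∀ y, (x, y) ∈ T → (k : ℝ) - 1 < |y| := by
    intro x
    by_cases hx : ∃ y, (x, y) ∈ T
    swap
    · exact ⟨0, 0, fun h => absurd h hx⟩
    have hex : ∃ k : ℕ, ∃ y, (x, y) ∈ T ∧ |y| ≤ k := by
      obtain ⟨y, hy⟩ := hx
      obtain ⟨n, hn⟩ := exists_nat_ge |y|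
      exact ⟨n, y, hy, hn⟩
    have hcomp : IsCompact {y : ℝ | (x, y) ∈ T ∧ |y| ≤ (Nat.find hex : ℕ)} := by
      refine (isCompact_Icc (a := -(Nat.find hex : ℝ)) (b := Nat.find hex)).of_isClosed_subset
        ?_ fun y hy => abs_le.1 hy.2
      exact (hT.preimage (by fun_prop : Continuous fun y : ℝ => (x, y))).inter
        (isClosed_le continuous_abs continuous_const)
    obtain ⟨s, hs, hmax⟩ := hcomp.exists_isGreatest (Nat.find_spec hex)
    refine ⟨s, Nat.find hex, fun _ => ⟨hs.1, hs.2, fun y h1 h2 => hmax ⟨h1, h2⟩, fun y hy => ?_⟩⟩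
    by_contra! hle
    rcases Nat.eq_zero_or_pos (Nat.find hex) with h0 | h0
    · rw [h0] at hle
      have := abs_nonneg y
      push_cast at hle
      linarith
    · refine Nat.find_min hex (Nat.sub_lt h0 one_pos) ⟨y, hy, ?_⟩
      rwa [Nat.cast_pred h0]
  choose s k h using h
  exact ⟨s, k, h⟩

lemma isClosed_slice {T : Set (ℝ × ℝ)} (hT : ∀ p ∈ T, p.1 ∈ Icc (0:ℝ) 1) (hc : IsClosed T)
    (r a : ℝ) : IsClosed {x : ℝ | ∃ y, (x, y) ∈ T ∧ |y| ≤ r ∧ a ≤ y} := by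
  have hcomp : IsCompact (T ∩ {p : ℝ × ℝ | |p.2| ≤ r ∧ a ≤ p.2}) := by
    have hbox : IsCompact (Icc (0:ℝ) 1 ×ˢ Icc (-r) r) := isCompact_Icc.prod isCompact_Icc
    refine hbox.of_isClosed_subset
      (hc.inter (.inter (isClosed_le (f := fun p : ℝ × ℝ => |p.2|) (by fun_prop) continuous_const)
        (isClosed_le continuous_const continuous_snd))) ?_
    rintro p ⟨hp, hr, -⟩
    exact ⟨hT p hp, abs_le.1 hr⟩
  convert (hcomp.image continuous_fst).isClosed using 1
  ext x
  constructor
  · rintro ⟨y, hy, h⟩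
    exact ⟨(x, y), ⟨hy, h⟩, rfl⟩
  · rintro ⟨⟨_, y⟩, ⟨hy, h⟩, rfl⟩
    exact ⟨y, hy, h⟩

/-- A closed planar set has a selection of the first Borel class. -/
lemma exists_Fσ_selection {T : Set (ℝ × ℝ)} (hT : ∀ p ∈ T, p.1 ∈ Icc (0:ℝ) 1)
    (hc : IsClosed T) :
    ∃ s : ℝ → ℝ, (∀ x, (∃ y, (x, y) ∈ T) → (x, s x) ∈ T) ∧
      ∀ ε > 0, ∃ 𝒜 : Set (Set ℝ), 𝒜.Countable ∧ (∀ A ∈ 𝒜, IsGδ Aᶜ) ∧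
        (∀ x, (∃ y, (x, y) ∈ T) → x ∈ ⋃₀ 𝒜) ∧
        ∀ A ∈ 𝒜, (∀ x ∈ A, ∃ y, (x, y) ∈ T) ∧ ∀ x ∈ A, ∀ y ∈ A, |s x - s y| < ε := by
  obtain ⟨s, k, hs⟩ := exists_selection hc
  refine ⟨s, fun x hx => (hs x hx).1, fun ε hε => ?_⟩
  let G : ℝ → ℝ → Set ℝ := fun r a => {x : ℝ | ∃ y, (x, y) ∈ T ∧ |y| ≤ r ∧ a ≤ y}
  have hG : ∀ r a, IsClosed (G r a) := isClosed_slice hT hc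
  let Q : ℕ × ℤ → Set ℝ := fun p => G p.1 (p.2 * ε) ∩ ((G (p.1 - 1) (-p.1))ᶜ ∩
    (G p.1 ((p.2 + 1) * ε))ᶜ)
  have hQ : ∀ p, ∀ x ∈ Q p, p.2 * ε ≤ s x ∧ s x < (p.2 + 1) * ε := by
    rintro ⟨j, q⟩ x ⟨⟨y, hy, hyj, hyq⟩, h2, h3⟩
    obtain ⟨hsT, hsk, hmax, hmin⟩ := hs x ⟨y, hy⟩
    have h1 : k x ≤ j := by
      have := (hmin y hy).trans_le hyj
      have : (k x : ℝ) < j + 1 := by simp only at this; linarith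
      exact Nat.lt_succ_iff.1 (by exact_mod_cast this)
    have h1' : ¬ k x < j := by
      intro hlt
      have : (k x : ℝ) + 1 ≤ j := by exact_mod_cast hlt
      refine h2 ⟨s x, hsT, by simp only; linarith, ?_⟩
      have := (abs_le.1 hsk).1
      simp only
      linarith
    have hkj : k x = j := by omega
    subst hkj
    refine ⟨hyq.trans (hmax y hy hyj), ?_⟩
    by_contra! hle
    exact h3 ⟨s x, hsT, hsk, hle⟩
  refine ⟨range Q, countable_range Q, ?_, ?_, ?_⟩
  · rintro _ ⟨p, rfl⟩
    simp only [Q, compl_inter, compl_compl]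
    exact (hG _ _).isOpen_compl.isGδ.union ((hG _ _).isGδ.union (hG _ _).isGδ)
  · intro x hx
    obtain ⟨hsT, hsk, hmax, hmin⟩ := hs x hx
    refine ⟨_, ⟨(k x, ⌊s x / ε⌋), rfl⟩, ⟨s x, hsT, hsk, ?_⟩, ?_, ?_⟩
    · exact (le_div_iff₀ hε).1 (Int.floor_le _)
    · rintro ⟨y, hy, hyk, -⟩
      exact absurd (hmin y hy) (not_lt.2 hyk)
    · rintro ⟨y, hy, hyk, hyq⟩
      have h1 := (div_lt_iff₀ hε).1 (Int.lt_floor_add_one (s x / ε))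
      have h2 := hmax y hy hyk
      simp only at hyq
      linarith
  · rintro _ ⟨p, rfl⟩
    refine ⟨fun x hx => ⟨_, hx.1.choose_spec.1⟩, fun x hx y hy => ?_⟩
    have h1 := hQ p x hx
    have h2 := hQ p y hy
    rw [abs_lt]
    constructor <;> linarith [h1.1, h1.2, h2.1, h2.2]

lemma Set.Countable.meagreIn01 {C : Set ℝ} (hC : C.Countable) : MeagreIn01 C := by
  have hpre : ((↑) ⁻¹' C : Set (Icc (0:ℝ) 1)).Countable := hC.preimage Subtype.val_injective
  have hconn : ConnectedSpace (Icc (0:ℝ) 1) :=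
    Subtype.connectedSpace (isConnected_Icc zero_le_one)
  have := isMeagre_biUnion (f := fun x : Icc (0:ℝ) 1 => {x}) hpre fun x _ => by
    exact residual_of_dense_open isOpen_compl_singleton (dense_compl_singleton x)
  rwa [biUnion_of_singleton] at this

lemma MeagreIn01.exists_near {B : Set ℝ} (hB : MeagreIn01 B) {x δ : ℝ} (hx : x ∈ Icc (0:ℝ) 1)
    (hδ : 0 < δ) : ∃ y ∈ Icc (0:ℝ) 1, y ∉ B ∧ dist y x < δ := by
  obtain ⟨y, hy, hyB⟩ := (dense_of_mem_residual hB).exists_mem_open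
    (isOpen_ball (x := (⟨x, hx⟩ : Icc (0:ℝ) 1)) (ε := δ)) ⟨_, mem_ball_self hδ⟩
  exact ⟨y, y.2, hy, hyB⟩

lemma MeagreIn01.exists_injective_near {B : Set ℝ} (hB : MeagreIn01 B) {x : ℕ → ℝ}
    (hx : ∀ i, x i ∈ Icc (0:ℝ) 1) : ∃ e : ℕ → ℝ, Function.Injective e ∧
      ∀ i, e i ∈ Icc (0:ℝ) 1 ∧ e i ∉ B ∧ dist (e i) (x i) < 1 / ((i:ℝ) + 1) := by
  classical
  have h : ∀ (i : ℕ) (S : Finset ℝ), ∃ y ∈ Icc (0:ℝ) 1, y ∉ B ∪ S ∧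
      dist y (x i) < 1 / ((i:ℝ) + 1) := fun i S =>
    MeagreIn01.exists_near (B := B ∪ S) (IsMeagre.union hB S.countable_toSet.meagreIn01) (hx i)
      Nat.one_div_pos_of_nat
  choose F hF01 hFB hFd using h
  let S : ℕ → Finset ℝ := fun n => Nat.rec ∅ (fun i S => insert (F i S) S) n
  have hS : ∀ i, S (i + 1) = insert (F i (S i)) (S i) := fun i => rfl
  have hmono : Monotone S := monotone_nat_of_le_succ fun i => by
    rw [hS]
    exact Finset.subset_insert _ _
  refine ⟨fun i => F i (S i), ?_, fun i => ⟨hF01 _ _, fun h => hFB i (S i) (Or.inl h), hFd _ _⟩⟩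
  refine Function.Injective.of_lt_imp_ne fun i j hij heq => hFB j (S j) (Or.inr ?_)
  have : F i (S i) ∈ S (i + 1) := by
    rw [hS]
    exact Finset.mem_insert_self _ _
  rw [← show F i (S i) = F j (S j) from heq]
  exact hmono (Nat.succ_le_of_lt hij) this

lemma isGδ_of_no_accPt {E : Set ℝ} (hE : ∀ x ∈ E, ¬ AccPt x (𝓟 E)) : IsGδ E := by
  have : E = closure E ∩ (derivedSet E)ᶜ := by
    rw [closure_eq_self_union_derivedSet]
    ext x
    have := hE x
    rw [← mem_derivedSet] at this
    simp only [mem_inter_iff, mem_union, mem_compl_iff]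
    tauto
  rw [this]
  exact isClosed_closure.isGδ.inter (isClosed_derivedSet E).isOpen_compl.isGδ

lemma exists_baire1_accPts_eq {T : Set (ℝ × ℝ)} (hT : ∀ p ∈ T, p.1 ∈ Icc (0:ℝ) 1)
    (hc : IsClosed T) (hC : {x ∈ Icc (0:ℝ) 1 | ∀ y : ℝ, (x, y) ∉ T}.Countable)
    (hD : MeagreIn01 {x : ℝ | ∃ y z : EReal,
      (x, y) ∈ closure (embedE '' T) ∧ (x, z) ∈ closure (embedE '' T) ∧ y ≠ z}) :
    ∃ f : ℝ → ℝ, Baire1 f ∧ accPts (graphOn (Icc 0 1) f) = T := by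
  classical
  set C := {x ∈ Icc (0:ℝ) 1 | ∀ y : ℝ, (x, y) ∉ T}
  set D := {x : ℝ | ∃ y z : EReal,
      (x, y) ∈ closure (embedE '' T) ∧ (x, z) ∈ closure (embedE '' T) ∧ y ≠ z}
  have hCfib : ∀ x ∈ Icc (0:ℝ) 1, x ∉ C → ∃ y, (x, y) ∈ T := fun x hx hxC => by
    by_contra! h
    exact hxC ⟨hx, h⟩
  have hCD : MeagreIn01 (C ∪ D) := IsMeagre.union hC.meagreIn01 hD
  have : Nonempty T := by
    obtain ⟨x, hx, hxCD, -⟩ := hCD.exists_near (left_mem_Icc.2 zero_le_one) one_pos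
    obtain ⟨y, hy⟩ := hCfib x hx fun h => hxCD (Or.inl h)
    exact ⟨⟨_, hy⟩⟩
  obtain ⟨d, hd⟩ := TopologicalSpace.exists_dense_seq T
  let p : ℕ → ℝ × ℝ := fun i => d i.unpair.2
  have hpT : ∀ i, p i ∈ T := fun i => (d i.unpair.2).2
  obtain ⟨e, hinj, he⟩ := hCD.exists_injective_near fun i => hT _ (hpT i)
  obtain ⟨s, hsT, hs⟩ := exists_Fσ_selection hT hc
  obtain ⟨ν, hν⟩ := countable_iff_exists_injOn.1 hC
  let f : ℝ → ℝ := Function.extend e (fun i => (p i).2) fun x => if x ∈ C then (ν x : ℝ) else s x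
  have hfe : ∀ i, f (e i) = (p i).2 := fun i => hinj.extend_apply _ _ i
  have hfC : ∀ x ∈ C, f x = ν x := fun x hx => by
    have : ¬ ∃ i, e i = x := by
      rintro ⟨i, rfl⟩
      exact (he i).2.1 (Or.inl hx)
    simp only [f, Function.extend_apply' _ _ _ this, if_pos hx]
  have hfs : ∀ x ∉ C, (¬ ∃ i, e i = x) → f x = s x := fun x hx hxe => by
    simp only [f, Function.extend_apply' _ _ _ hxe, if_neg hx]
  clear_value f
  have hlarge : ∀ δ > 0, ∀ᶠ i : ℕ in atTop, 1 / ((i:ℝ) + 1) < δ := fun δ hδ =>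
    tendsto_one_div_add_atTop_nhds_zero_nat.eventually (gt_mem_nhds hδ)
  refine ⟨f, baire1_of_Fσ_cover fun ε hε => ?_, Subset.antisymm ?_ ?_⟩
  · set E := {x ∈ Icc (0:ℝ) 1 | x ∉ C ∧ ε / 3 ≤ |f x - s x|}
    have hEe : E ⊆ range e := by
      rintro x ⟨-, hxC, hx⟩
      by_contra hxe
      rw [hfs x hxC hxe, sub_self, abs_zero] at hx
      linarith
    have hEG : IsGδ E := by
      refine isGδ_of_no_accPt fun x hx hacc => ?_
      obtain ⟨η, hη⟩ := hCfib x hx.1 hx.2.1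
      obtain ⟨i₀, rfl⟩ := hEe hx
      have hxD : e i₀ ∉ D := fun h => (he i₀).2.1 (Or.inr h)
      obtain ⟨δ, hδ, hball⟩ :=
        Metric.eventually_nhds_iff.1 (eventually_fiber_close hη hxD (ε := ε / 6) (by positivity))
      obtain ⟨N, hN⟩ := eventually_atTop.1 (hlarge (δ / 2) (by positivity))
      have hfin : (e '' Iio N \ {e i₀}).Finite := ((finite_Iio N).image e).sdiff
      have hnear : ∀ᶠ y in 𝓝 (e i₀), y ∉ e '' Iio N \ {e i₀} ∧ dist y (e i₀) < δ / 2 :=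
        Eventually.and (hfin.isClosed.isOpen_compl.mem_nhds fun h => h.2 rfl)
          (ball_mem_nhds _ (by positivity))
      obtain ⟨y, ⟨hne, hyE⟩, hyN, hyd⟩ :=
        ((accPt_iff_frequently.1 hacc).and_eventually hnear).exists
      obtain ⟨i, rfl⟩ := hEe hyE
      have hi : N ≤ i := by
        by_contra! hlt
        exact hyN ⟨⟨i, hlt, rfl⟩, hne⟩
      have h1 : |s (e i) - η| < ε / 6 := hball (by linarith) _ (hsT _ (hCfib _ hyE.1 hyE.2.1))
      have h2 : |(p i).2 - η| < ε / 6 := by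
        refine hball (y := (p i).1) ?_ _ (hpT i)
        have := dist_triangle_left (p i).1 (e i₀) (e i)
        linarith [(he i).2.2, hN i hi]
      have h3 := hyE.2.2
      rw [hfe] at h3
      have := abs_sub_le (p i).2 η (s (e i))
      rw [abs_sub_comm η] at this
      linarith
    obtain ⟨𝒜, hcount, hG, hcov, hosc⟩ := hs (ε / 3) (by positivity)
    have hcountCE : (C ∪ E).Countable := hC.union ((countable_range e).mono hEe)
    refine ⟨(fun x => {x}) '' (C ∪ E) ∪ (fun A => A ∩ Eᶜ) '' 𝒜,
      (hcountCE.image _).union (hcount.image _), ?_, ?_, ?_⟩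
    · rintro _ (⟨z, -, rfl⟩ | ⟨A, hA, rfl⟩)
      · exact isOpen_compl_singleton.isGδ
      · rw [compl_inter, compl_compl]
        exact (hG A hA).union hEG
    · intro x hx
      by_cases hxCE : x ∈ C ∪ E
      · exact ⟨{x}, Or.inl ⟨x, hxCE, rfl⟩, rfl⟩
      · obtain ⟨A, hA, hxA⟩ := hcov x (hCfib x hx fun h => hxCE (Or.inl h))
        exact ⟨_, Or.inr ⟨A, hA, rfl⟩, hxA, fun h => hxCE (Or.inr h)⟩
    · rintro _ (⟨z, -, rfl⟩ | ⟨A, hA, rfl⟩)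
      · rintro x rfl y rfl
        simpa using hε
      · have hfs' : ∀ x ∈ A ∩ Eᶜ, |f x - s x| < ε / 3 := by
          rintro x ⟨hxA, hxE⟩
          by_contra! hle
          obtain ⟨y, hy⟩ := (hosc A hA).1 x hxA
          exact hxE ⟨hT _ hy, fun h => h.2 y hy, hle⟩
        intro x hx y hy
        have h1 := abs_lt.1 (hfs' x hx)
        have h2 := abs_lt.1 (hfs' y hy)
        have h3 := abs_lt.1 ((hosc A hA).2 x hx.1 y hy.1)
        rw [abs_lt]
        constructor <;> linarith [h1.1, h1.2, h2.1, h2.2, h3.1, h3.2]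
  · intro t ht
    by_contra htT
    obtain ⟨δ, hδ, hball⟩ := Metric.isOpen_iff.1 hc.isOpen_compl t htT
    obtain ⟨N, hN⟩ := eventually_atTop.1 (hlarge (δ / 2) (by positivity))
    obtain ⟨M, hM⟩ := exists_nat_ge (|t.2| + δ)
    have hfinC : {x ∈ C | ν x ≤ M}.Finite :=
      Finite.of_finite_image ((finite_Iic M).subset (by rintro _ ⟨x, hx, rfl⟩; exact hx.2))
        (hν.mono fun x hx => hx.1)
    have hfin : ((fun x => (x, f x)) '' (e '' Iio N ∪ {x ∈ C | ν x ≤ M})).Finite :=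
      (((finite_Iio N).image e).union hfinC).image _
    have hinf : (ball t (δ / 2) ∩ graphOn (Icc 0 1) f).Infinite :=
      Set.Infinite.of_accPt (AccPt.nhds_inter ht (ball_mem_nhds _ (by positivity)))
    refine hinf (hfin.subset ?_)
    rintro ⟨x, y⟩ ⟨hxt, hx, hxy⟩
    obtain rfl : y = f x := hxy
    refine ⟨x, ?_, rfl⟩
    have hxt2 : dist (f x) t.2 < δ / 2 := (le_max_right _ _).trans_lt hxt
    by_cases hxC : x ∈ C
    · refine Or.inr ⟨hxC, ?_⟩
      rw [hfC x hxC, Real.dist_eq] at hxt2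
      have h1 := (abs_lt.1 hxt2).2
      have h2 := le_abs_self t.2
      have : (ν x : ℝ) ≤ M := by linarith
      exact_mod_cast this
    left
    by_cases hxe : ∃ i, e i = x
    · obtain ⟨i, rfl⟩ := hxe
      refine ⟨i, ?_, rfl⟩
      by_contra hi
      refine hball ?_ (hpT i)
      have h1 : dist (p i) (e i, f (e i)) < δ / 2 := by
        rw [Prod.dist_eq, hfe, dist_self, max_eq_left dist_nonneg, dist_comm]
        exact (he i).2.2.trans (hN i (not_lt.1 hi))
      rw [mem_ball] at hxt ⊢
      linarith [dist_triangle (p i) (e i, f (e i)) t]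
    · refine absurd (hsT x (hCfib x hx hxC)) (hball ?_)
      rw [← hfs x hxC hxe]
      exact ball_subset_ball (by linarith) hxt
  · intro t ht
    refine accPt_iff_nhds.2 fun U hU => ?_
    obtain ⟨δ, hδ, hball⟩ := Metric.mem_nhds_iff.1 hU
    obtain ⟨j, hj⟩ := hd.exists_dist_lt ⟨t, ht⟩ (half_pos hδ)
    have hev : ∀ᶠ m : ℕ in atTop, 1 / ((m:ℝ) + 1) < δ / 2 ∧ e (Nat.pair m j) ≠ t.1 := by
      refine (hlarge _ (by positivity)).and ?_
      have hpair : Function.Injective fun m => e (Nat.pair m j) := fun a b h => by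
        have := Nat.pair_eq_pair.1 (hinj h)
        exact this.1
      have := hpair.tendsto_cofinite.eventually (finite_singleton t.1).compl_mem_cofinite
      rwa [Nat.cofinite_eq_atTop] at this
    obtain ⟨m, hm, hne⟩ := hev.exists
    refine ⟨(e (Nat.pair m j), f (e (Nat.pair m j))), ⟨hball ?_, (he _).1, rfl⟩,
      fun h => hne (congrArg Prod.fst h)⟩
    have hp : p (Nat.pair m j) = d j := by simp [p]
    have h1 : dist (e (Nat.pair m j), f (e (Nat.pair m j))) (d j : ℝ × ℝ) < δ / 2 := by
      rw [hfe, hp, Prod.dist_eq, dist_self, max_eq_left dist_nonneg, ← hp]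
      refine (he _).2.2.trans (lt_of_le_of_lt ?_ hm)
      have : (m : ℝ) ≤ Nat.pair m j := by exact_mod_cast Nat.left_le_pair m j
      gcongr
    have h2 : dist t (d j : ℝ × ℝ) < δ / 2 := hj
    rw [mem_ball]
    linarith [dist_triangle_right (e (Nat.pair m j), f (e (Nat.pair m j))) t (d j : ℝ × ℝ)]

theorem stmt15 (T : Set (ℝ × ℝ)) (hT : ∀ p ∈ T, p.1 ∈ Icc (0:ℝ) 1) :
    (∃ f : ℝ → ℝ, Baire1 f ∧ accPts (graphOn (Icc 0 1) f) = T) ↔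
      (IsClosed T ∧ {x ∈ Icc (0:ℝ) 1 | ∀ y : ℝ, (x, y) ∉ T}.Countable ∧
        MeagreIn01 {x : ℝ | ∃ y z : EReal,
          (x, y) ∈ closure (embedE '' T) ∧ (x, z) ∈ closure (embedE '' T) ∧ y ≠ z}) := by
  refine ⟨?_, fun ⟨hc, hC, hD⟩ => exists_baire1_accPts_eq hT hc hC hD⟩
  rintro ⟨f, hf, rfl⟩
  exact ⟨isClosed_accPts _, countable_empty_fibers f, hf.meagreIn01 rfl⟩
end
end

section
/- Suppose T ⊆ [0,1] × ℝ satisfies the conditions for the existence of a Baire class 1 function f with L_f = T (T closed, {x : T(x) = ∅} countable, {x : #(T̄(x)) > 1} meager, where T̄ is the closure of T in [0,1] × [-∞,∞]). Then f can be chosen to additionally satisfy that the closure of L_f in [0,1] × [-∞,∞] equals T̄. -/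
open Set Filter Topology Metric

noncomputable section

/-- `E` is a countable union of closed sets on each of which `f` oscillates by at most `ε`. -/
def SmallOscCover (E : Set ℝ) (f : ℝ → ℝ) (ε : ℝ) : Prop :=
  ∃ F : ℕ → Set ℝ, (∀ n, IsClosed (F n)) ∧ ⋃ n, F n = E ∧
    ∀ n, ∀ x ∈ F n, ∀ y ∈ F n, |f x - f y| ≤ ε

theorem SmallOscCover.of_locallyClosed {ι : Type*} [Countable ι] [Nonempty ι] {E : Set ℝ}
    {f : ℝ → ℝ} {ε : ℝ} (B U : ι → Set ℝ) (hB : ∀ i, IsClosed (B i)) (hU : ∀ i, IsOpen (U i))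
    (hE : ⋃ i, B i ∩ U i = E)
    (hosc : ∀ i, ∀ x ∈ B i ∩ U i, ∀ y ∈ B i ∩ U i, |f x - f y| ≤ ε) : SmallOscCover E f ε := by
  choose G hGc hGU hGe _ using fun i => (hU i).exists_iUnion_isClosed
  obtain ⟨e, he⟩ := exists_surjective_nat (ι × ℕ)
  refine ⟨fun n => B (e n).1 ∩ G (e n).1 (e n).2, fun n => (hB _).inter (hGc _ _), ?_, ?_⟩
  · rw [← hE]
    ext x
    simp only [mem_iUnion, mem_inter_iff]
    constructor
    · rintro ⟨n, h1, h2⟩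
      exact ⟨_, h1, hGU _ _ h2⟩
    · rintro ⟨i, h1, h2⟩
      rw [← hGe i] at h2
      obtain ⟨m, hm⟩ := mem_iUnion.1 h2
      obtain ⟨n, hn⟩ := he (i, m)
      exact ⟨n, by rw [hn]; exact ⟨h1, hm⟩⟩
  · intro n x hx y hy
    exact hosc _ x ⟨hx.1, hGU _ _ hx.2⟩ y ⟨hy.1, hGU _ _ hy.2⟩

/-- The indicator of a closed set is a limit of continuous functions, eventually constant at
each point. -/
theorem IsClosed.exists_continuous_eventually_indicator {F : Set ℝ} (hF : IsClosed F) :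
    ∃ e : ℕ → ℝ → ℝ, (∀ n, Continuous (e n)) ∧ (∀ n, ∀ x ∈ F, e n x = 1) ∧
      ∀ x ∉ F, ∀ᶠ n in atTop, e n x = 0 := by
  rcases F.eq_empty_or_nonempty with rfl | hne
  · exact ⟨fun _ _ => 0, fun _ => continuous_const, by simp, by simp⟩
  refine ⟨fun n x => max 0 (1 - n * infDist x F), fun n => ?_, fun n x hx => ?_, fun x hx => ?_⟩
  · have := continuous_infDist_pt F
    fun_prop
  · simp [infDist_zero_of_mem hx]
  · have hpos : 0 < infDist x F := (hF.notMem_iff_infDist_pos hne).1 hx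
    obtain ⟨N, hN⟩ := exists_nat_gt (1 / infDist x F)
    filter_upwards [eventually_ge_atTop N] with n hn
    have h1 : 1 < (N : ℝ) * infDist x F := by rwa [div_lt_iff₀ hpos] at hN
    have h2 : (N : ℝ) * infDist x F ≤ n * infDist x F := by gcongr
    exact max_eq_left (by linarith)

theorem SmallOscCover.exists_baire1 {f : ℝ → ℝ} {ε : ℝ} (h : SmallOscCover (Icc 0 1) f ε) :
    ∃ c, Baire1 c ∧ ∀ x ∈ Icc (0:ℝ) 1, |c x - f x| ≤ ε := by
  classical
  obtain ⟨F, hF, hcov, hosc⟩ := h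
  choose e hec he1 he0 using fun i => (hF i).exists_continuous_eventually_indicator
  let a : ℕ → ℝ := fun i => if h : (F i).Nonempty then f h.some else 0
  have hex : ∀ x ∈ Icc (0:ℝ) 1, ∃ i, x ∈ F i := fun x hx => by
    rw [← hcov] at hx
    exact mem_iUnion.1 hx
  refine ⟨fun x => if h : ∃ i, x ∈ F i then a (Nat.find h) else 0,
    ⟨fun n x => ∑ i ∈ Finset.range n, a i * (e i n x * ∏ l ∈ Finset.range i, (1 - e l n x)),
      fun n => Continuous.continuousOn ?_, fun x hx => ?_⟩, fun x hx => ?_⟩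
  · fun_prop
  · beta_reduce
    rw [dif_pos (hex x hx)]
    set k := Nat.find (hex x hx) with hk
    have hxk : x ∈ F k := Nat.find_spec (hex x hx)
    have hlt : ∀ᶠ n in atTop, ∀ l ∈ Finset.range k, e l n x = 0 := by
      rw [Filter.eventually_all_finset]
      intro l hl
      exact he0 l x (Nat.find_min (hex x hx) (Finset.mem_range.1 hl))
    apply tendsto_const_nhds.congr'
    filter_upwards [hlt, eventually_gt_atTop k] with n hn hkn
    rw [Finset.sum_eq_single k]
    · rw [he1 k n x hxk, Finset.prod_eq_one]
      · simp
      · intro l hl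
        simp [hn l hl]
    · intro i _ hik
      rcases lt_or_gt_of_ne hik with h | h
      · simp [hn i (Finset.mem_range.2 h)]
      · rw [Finset.prod_eq_zero (Finset.mem_range.2 h)]
        · simp
        · simp [he1 k n x hxk]
    · intro h
      exact absurd (Finset.mem_range.2 hkn) h
  · beta_reduce
    rw [dif_pos (hex x hx)]
    have hxk : x ∈ F (Nat.find (hex x hx)) := Nat.find_spec (hex x hx)
    have hne : (F (Nat.find (hex x hx))).Nonempty := ⟨x, hxk⟩
    simp only [a, dif_pos hne]
    exact hosc _ _ hne.some_mem _ hxk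

theorem Baire1.of_smallOscCover {f : ℝ → ℝ} (h : ∀ ε > 0, SmallOscCover (Icc 0 1) f ε) :
    Baire1 f := by
  choose c hc hcf using fun k : ℕ => (h ((1 / 2) ^ k) (by positivity)).exists_baire1
  choose g hg hgc using hc
  let b : ℕ → ℝ := fun k => 2 * (1 / 2) ^ k
  have hb0 : ∀ k, 0 ≤ b k := fun k => by positivity
  have hb : Summable b := summable_geometric_two.mul_left 2
  let φ : ℕ → ℝ → ℝ := fun k y => max (-b k) (min (b k) y)
  have hφc : ∀ k, Continuous (φ k) := fun k => by fun_prop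
  have hφb : ∀ k y, ‖φ k y‖ ≤ b k := fun k y =>
    abs_le.2 ⟨le_max_left _ _, max_le (by linarith [hb0 k]) (min_le_left _ _)⟩
  refine ⟨fun n x => g 0 n x + ∑' k, φ k (g (k + 1) n x - g k n x), fun n => ?_, fun x hx => ?_⟩
  · refine (hg 0 n).add (continuousOn_tsum (u := b) (fun k => ?_) hb fun k x _ => hφb _ _)
    exact (hφc k).comp_continuousOn ((hg (k + 1) n).sub (hg k n))
  · have hlim : Tendsto (fun k => c k x) atTop (𝓝 (f x)) := by
      rw [tendsto_iff_dist_tendsto_zero]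
      refine squeeze_zero (fun _ => dist_nonneg) (fun k => ?_)
        (tendsto_pow_atTop_nhds_zero_of_lt_one (r := (1 / 2 : ℝ)) (by norm_num) (by norm_num))
      exact hcf k x hx
    have hφd : ∀ k, φ k (c (k + 1) x - c k x) = c (k + 1) x - c k x := fun k => by
      have h1 := abs_le.1 (hcf k x hx)
      have h2 := abs_le.1 (hcf (k + 1) x hx)
      have h3 : (0:ℝ) < (1 / 2) ^ k := by positivity
      rw [pow_succ] at h2
      simp only [φ, b]
      rw [min_eq_right (by linarith), max_eq_right (by linarith)]
    have hsum : ∑' k, φ k (c (k + 1) x - c k x) = f x - c 0 x := by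
      have hs : Summable fun k => φ k (c (k + 1) x - c k x) :=
        Summable.of_norm_bounded hb fun k => hφb _ _
      refine tendsto_nhds_unique hs.hasSum.tendsto_sum_nat ?_
      simp only [hφd, Finset.sum_range_sub (fun k => c k x)]
      exact hlim.sub_const _
    have hT : Tendsto (fun n => ∑' k, φ k (g (k + 1) n x - g k n x)) atTop
        (𝓝 (∑' k, φ k (c (k + 1) x - c k x))) :=
      tendsto_tsum_of_dominated_convergence hb
        (fun k => ((hφc k).tendsto _).comp ((hgc (k + 1) x hx).sub (hgc k x hx)))
        (Eventually.of_forall fun n k => hφb _ _)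
    have := (hgc 0 x hx).add hT
    rwa [hsum, add_sub_cancel] at this

theorem Baire1.of_arctan {f : ℝ → ℝ} (h : Baire1 fun x => Real.arctan (f x)) : Baire1 f := by
  obtain ⟨g, hg, hgf⟩ := h
  let b : ℕ → ℝ := fun n => Real.pi / 2 - 1 / ((n : ℝ) + 1)
  have hb0 : ∀ n, 0 < b n := fun n => by
    have h1 : 1 / ((n : ℝ) + 1) ≤ 1 := by
      rw [div_le_one (by positivity)]
      linarith [n.cast_nonneg (α := ℝ)]
    simp only [b]
    linarith [Real.pi_gt_three]
  have hb1 : ∀ n, b n < Real.pi / 2 := fun n => by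
    have : 0 < 1 / ((n : ℝ) + 1) := by positivity
    simp only [b]
    linarith
  have hb : Tendsto b atTop (𝓝 (Real.pi / 2)) := by
    simpa [b] using (tendsto_const_nhds (x := Real.pi / 2)).sub
      (tendsto_one_div_add_atTop_nhds_zero_nat (𝕜 := ℝ))
  refine ⟨fun n x => Real.tan (max (-b n) (min (b n) (g n x))), fun n => ?_, fun x hx => ?_⟩
  · refine Real.continuousOn_tan_Ioo.comp
      (continuousOn_const.sup (continuousOn_const.inf (hg n))) fun x _ => ⟨?_, ?_⟩
    · exact (neg_lt_neg (hb1 n)).trans_le (le_max_left _ _)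
    · exact max_lt (by linarith [hb0 n, hb1 n]) ((min_le_left _ _).trans_lt (hb1 n))
  · have h1 := Real.neg_pi_div_two_lt_arctan (f x)
    have h2 := Real.arctan_lt_pi_div_two (f x)
    have hl := hb.neg.max (hb.min (hgf x hx))
    rw [min_eq_right h2.le, max_eq_right h1.le] at hl
    have := (Real.continuousOn_tan_Ioo.continuousAt (Ioo_mem_nhds h1 h2)).tendsto.comp hl
    rwa [Real.tan_arctan] at this

/-- The points of the line over which `T` meets the horizontal strip `[a, b]`. -/
def stripShadow (T : Set (ℝ × ℝ)) (a b : ℝ) : Set ℝ := {x | ∃ y ∈ Icc a b, (x, y) ∈ T}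

theorem isClosed_stripShadow {T : Set (ℝ × ℝ)} (hT : ∀ p ∈ T, p.1 ∈ Icc (0:ℝ) 1)
    (hTc : IsClosed T) (a b : ℝ) : IsClosed (stripShadow T a b) := by
  have h : stripShadow T a b = Prod.fst '' (Icc (0:ℝ) 1 ×ˢ Icc a b ∩ T) := by
    ext x
    constructor
    · rintro ⟨y, hy, hxy⟩
      exact ⟨(x, y), ⟨⟨hT _ hxy, hy⟩, hxy⟩, rfl⟩
    · rintro ⟨⟨x', y⟩, ⟨⟨-, hy⟩, hxy⟩, rfl⟩
      exact ⟨y, hy, hxy⟩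
  rw [h]
  exact (((isCompact_Icc.prod isCompact_Icc).inter_right hTc).image continuous_fst).isClosed

theorem exists_selection_isLeast {T : Set (ℝ × ℝ)} (hTc : IsClosed T) :
    ∃ f : ℝ → ℝ, ∀ x, (∃ y, (x, y) ∈ T) → ∃ n : ℕ,
      IsLeast {y | y ∈ Icc (-n : ℝ) n ∧ (x, y) ∈ T} (f x) ∧
        x ∉ stripShadow T (-((n : ℝ) - 1)) (n - 1) := by
  classical
  have key : ∀ x, ∃ z, (∃ y, (x, y) ∈ T) → ∃ n : ℕ,
      IsLeast {y | y ∈ Icc (-n : ℝ) n ∧ (x, y) ∈ T} z ∧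
        x ∉ stripShadow T (-((n : ℝ) - 1)) (n - 1) := by
    intro x
    by_cases hx : ∃ y, (x, y) ∈ T
    · have hex : ∃ n : ℕ, x ∈ stripShadow T (-n) n := by
        obtain ⟨y, hy⟩ := hx
        obtain ⟨n, hn⟩ := exists_nat_ge |y|
        exact ⟨n, y, abs_le.1 hn, hy⟩
      have hspec := Nat.find_spec hex
      have hmin := fun m => Nat.find_min hex (m := m)
      set n := Nat.find hex
      have hcl : IsClosed {y | (x, y) ∈ T} := hTc.preimage (by fun_prop : Continuous fun y => (x, y))
      have hK : IsCompact {y | y ∈ Icc (-n : ℝ) n ∧ (x, y) ∈ T} := isCompact_Icc.inter_right hcl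
      obtain ⟨z, hz⟩ := hK.exists_isLeast hspec
      refine ⟨z, fun _ => ⟨n, hz, ?_⟩⟩
      rcases Nat.eq_zero_or_pos n with h0 | hpos
      · rintro ⟨y, hy, -⟩
        rw [h0] at hy
        have := hy.1.trans hy.2
        norm_num at this
      · have := hmin (n - 1) (by omega)
        rwa [Nat.cast_pred hpos] at this
    · exact ⟨0, fun h => absurd h hx⟩
  choose f hf using key
  exact ⟨f, hf⟩

theorem exists_selection_s19 {T : Set (ℝ × ℝ)} (hT : ∀ p ∈ T, p.1 ∈ Icc (0:ℝ) 1)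
    (hTc : IsClosed T) :
    ∃ f : ℝ → ℝ, (∀ x, (∃ y, (x, y) ∈ T) → (x, f x) ∈ T) ∧
      ∀ ε > 0, SmallOscCover {x | ∃ y, (x, y) ∈ T} f ε := by
  obtain ⟨f, hf⟩ := exists_selection_isLeast hTc
  refine ⟨f, fun x hx => ?_, fun ε hε => ?_⟩
  · obtain ⟨n, hn, -⟩ := hf x hx
    exact hn.1.2
  have key : ∀ (n q : ℕ) (x : ℝ), x ∈ stripShadow T (-n) (min n (-n + q * ε)) →
      x ∉ stripShadow T (-n) (min n (-n + (q - 1) * ε)) →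
      x ∉ stripShadow T (-((n : ℝ) - 1)) (n - 1) →
      f x ≤ -n + q * ε ∧ -n + (q - 1) * ε < f x := by
    rintro n q x ⟨y, hy, hxy⟩ h2 h3
    obtain ⟨m, hm, hm'⟩ := hf x ⟨y, hxy⟩
    have hyn : y ≤ n := hy.2.trans (min_le_left _ _)
    have hmn : m = n := by
      rcases lt_trichotomy m n with h | h | h
      · have h' : (m : ℝ) + 1 ≤ n := by exact_mod_cast h
        exact absurd ⟨f x, ⟨by linarith [hm.1.1.1], by linarith [hm.1.1.2]⟩, hm.1.2⟩ h3
      · exact h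
      · have h' : (n : ℝ) + 1 ≤ m := by exact_mod_cast h
        exact absurd ⟨y, ⟨by linarith [hy.1], by linarith⟩, hxy⟩ hm'
    subst hmn
    refine ⟨(hm.2 ⟨⟨hy.1, hyn⟩, hxy⟩).trans (hy.2.trans (min_le_right _ _)), ?_⟩
    by_contra! h
    exact h2 ⟨f x, ⟨hm.1.1.1, le_min hm.1.1.2 h⟩, hm.1.2⟩
  refine SmallOscCover.of_locallyClosed (ι := ℕ × ℕ)
    (fun i => stripShadow T (-i.1) (min i.1 (-i.1 + i.2 * ε)))
    (fun i => (stripShadow T (-i.1) (min i.1 (-i.1 + (i.2 - 1) * ε)))ᶜ ∩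
      (stripShadow T (-((i.1 : ℝ) - 1)) (i.1 - 1))ᶜ)
    (fun i => isClosed_stripShadow hT hTc _ _)
    (fun i => (isClosed_stripShadow hT hTc _ _).isOpen_compl.inter
      (isClosed_stripShadow hT hTc _ _).isOpen_compl) ?_ ?_
  · ext x
    simp only [mem_iUnion]
    constructor
    · rintro ⟨i, ⟨y, -, hy⟩, -⟩
      exact ⟨y, hy⟩
    · intro hx
      obtain ⟨n, hn, hn'⟩ := hf x hx
      have h0 : 0 ≤ (f x + n) / ε := div_nonneg (by linarith [hn.1.1.1]) hε.le
      refine ⟨(n, ⌈(f x + n) / ε⌉₊), ⟨f x, ⟨hn.1.1.1, le_min hn.1.1.2 ?_⟩, hn.1.2⟩, ?_, hn'⟩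
      · have := Nat.le_ceil ((f x + n) / ε)
        rw [div_le_iff₀ hε] at this
        linarith
      · rintro ⟨y, hy, hxy⟩
        have h1 : f x ≤ y := hn.2 ⟨⟨hy.1, hy.2.trans (min_le_left _ _)⟩, hxy⟩
        have h2 := hy.2.trans (min_le_right _ _)
        have h3 := Nat.ceil_lt_add_one h0
        have h4 : ((⌈(f x + n) / ε⌉₊ : ℝ) - 1) * ε < f x + n := by
          rw [← lt_div_iff₀ hε]
          linarith
        simp only at h2
        linarith
  · rintro ⟨n, q⟩ x ⟨hx1, hx2, hx3⟩ y ⟨hy1, hy2, hy3⟩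
    have hx := key n q x hx1 hx2 hx3
    have hy := key n q y hy1 hy2 hy3
    rw [abs_le]
    constructor <;> linarith [hx.1, hx.2, hy.1, hy.2]

theorem MeagreIn01.exists_mem_compl {M : Set ℝ} (hM : MeagreIn01 M) {C : Set ℝ}
    (hC : C.Countable) {s r : ℝ} (hs : s ∈ Icc (0:ℝ) 1) (hr : 0 < r) :
    ∃ x ∈ Icc (0:ℝ) 1, x ∉ M ∧ x ∉ C ∧ |x - s| < r := by
  have : ConnectedSpace (Icc (0:ℝ) 1) := Subtype.connectedSpace (isConnected_Icc zero_le_one)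
  have hC' : IsMeagre ((↑) ⁻¹' C : Set (Icc (0:ℝ) 1)) := by
    have hc : ((↑) ⁻¹' C : Set (Icc (0:ℝ) 1)).Countable := hC.preimage Subtype.val_injective
    rw [← biUnion_of_singleton ((↑) ⁻¹' C : Set (Icc (0:ℝ) 1))]
    refine isMeagre_biUnion hc fun x _ => IsNowhereDense.isMeagre ?_
    rw [isClosed_singleton.isNowhereDense_iff]
    exact interior_singleton x
  obtain ⟨x, hx, hxs⟩ := (dense_of_mem_residual (hM.union hC')).exists_dist_lt ⟨s, hs⟩ hr
  rw [mem_compl_iff, mem_union, not_or] at hx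
  refine ⟨x, x.2, hx.1, hx.2, ?_⟩
  rw [dist_comm] at hxs
  exact hxs

theorem MeagreIn01.exists_injective_seq {M : Set ℝ} (hM : MeagreIn01 M) {C : Set ℝ}
    (hC : C.Countable) {s : ℕ → ℝ} (hs : ∀ j, s j ∈ Icc (0:ℝ) 1) :
    ∃ x : ℕ → ℝ, Function.Injective x ∧ ∀ j, x j ∈ Icc (0:ℝ) 1 ∧ x j ∉ M ∧ x j ∉ C ∧
      x j ≠ s j ∧ |x j - s j| < 1 / ((j : ℝ) + 1) := by
  classical
  have key : ∀ (A : Finset ℝ) (j : ℕ), ∃ x ∈ Icc (0:ℝ) 1, x ∉ M ∧ x ∉ C ∪ (A ∪ {s j}) ∧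
      |x - s j| < 1 / ((j : ℝ) + 1) := fun A j =>
    hM.exists_mem_compl (hC.union (A.countable_toSet.union (countable_singleton _))) (hs j)
      (by positivity)
  choose pick h01 hpM hpA hps using key
  let A : ℕ → Finset ℝ := fun n => Nat.rec ∅ (fun n B => insert (pick B n) B) n
  have hA : ∀ n, A (n + 1) = insert (pick (A n) n) (A n) := fun n => rfl
  have hmono : Monotone A := monotone_nat_of_le_succ fun n => by
    rw [hA]
    exact Finset.subset_insert _ _
  refine ⟨fun j => pick (A j) j, Function.Injective.of_lt_imp_ne fun i j hij h => ?_, fun j => ?_⟩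
  · have h1 : pick (A i) i ∈ A j := hmono (Nat.succ_le_of_lt hij) (Finset.mem_insert_self _ _)
    have h2 := hpA (A j) j
    simp only [mem_union, not_or, Finset.mem_coe] at h2
    exact h2.2.1 (h ▸ h1)
  · have h2 := hpA (A j) j
    simp only [mem_union, not_or, mem_singleton_iff] at h2
    exact ⟨h01 _ _, hpM _ _, h2.1, h2.2.2, hps _ _⟩

/-- The closure of `T` after the second coordinate has been compressed by `arctan`. -/
def arctanClosure (T : Set (ℝ × ℝ)) : Set (ℝ × ℝ) :=
  closure ((fun p : ℝ × ℝ => (p.1, Real.arctan p.2)) '' T)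

/-- The points over which `arctanClosure T` has two points at distance at least `ε`. -/
def gapSet (T : Set (ℝ × ℝ)) (ε : ℝ) : Set ℝ :=
  {x | ∃ u v, (x, u) ∈ arctanClosure T ∧ (x, v) ∈ arctanClosure T ∧ ε ≤ |u - v|}

theorem mem_arctanClosure {T : Set (ℝ × ℝ)} {x y : ℝ} (h : (x, y) ∈ T) :
    (x, Real.arctan y) ∈ arctanClosure T :=
  subset_closure ⟨(x, y), h, rfl⟩

theorem arctanClosure_subset {T : Set (ℝ × ℝ)} (hT : ∀ p ∈ T, p.1 ∈ Icc (0:ℝ) 1) :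
    arctanClosure T ⊆ Icc (0:ℝ) 1 ×ˢ Icc (-(Real.pi / 2)) (Real.pi / 2) := by
  refine closure_minimal ?_ (isClosed_Icc.prod isClosed_Icc)
  rintro _ ⟨p, hp, rfl⟩
  exact ⟨hT p hp, (Real.neg_pi_div_two_lt_arctan _).le, (Real.arctan_lt_pi_div_two _).le⟩

theorem isCompact_arctanClosure {T : Set (ℝ × ℝ)} (hT : ∀ p ∈ T, p.1 ∈ Icc (0:ℝ) 1) :
    IsCompact (arctanClosure T) :=
  (isCompact_Icc.prod isCompact_Icc).of_isClosed_subset isClosed_closure (arctanClosure_subset hT)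

theorem isClosed_gapSet {T : Set (ℝ × ℝ)} (hT : ∀ p ∈ T, p.1 ∈ Icc (0:ℝ) 1) (ε : ℝ) :
    IsClosed (gapSet T ε) := by
  have hK := isCompact_arctanClosure hT
  have h : gapSet T ε = (fun q : (ℝ × ℝ) × (ℝ × ℝ) => q.1.1) ''
      (arctanClosure T ×ˢ arctanClosure T ∩ {q | q.1.1 = q.2.1 ∧ ε ≤ |q.1.2 - q.2.2|}) := by
    ext x
    constructor
    · rintro ⟨u, v, hu, hv, huv⟩
      exact ⟨((x, u), (x, v)), ⟨⟨hu, hv⟩, rfl, huv⟩, rfl⟩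
    · rintro ⟨⟨⟨x, u⟩, ⟨x', v⟩⟩, ⟨⟨hu, hv⟩, h, huv⟩, rfl⟩
      obtain rfl : x = x' := h
      exact ⟨u, v, hu, hv, huv⟩
  rw [h]
  have h1 : IsClosed {q : (ℝ × ℝ) × (ℝ × ℝ) | q.1.1 = q.2.1} :=
    isClosed_eq (by fun_prop) (by fun_prop)
  have h2 : IsClosed {q : (ℝ × ℝ) × (ℝ × ℝ) | ε ≤ |q.1.2 - q.2.2|} :=
    isClosed_le (by fun_prop) (by fun_prop)
  exact (((hK.prod hK).inter_right (h1.inter h2)).image (by fun_prop)).isClosed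

/-- The inverse of `arctan`, extended to `[-π/2, π/2]` with values in `EReal`. -/
def tanE (u : ℝ) : EReal :=
  if u = Real.pi / 2 then ⊤ else if u = -(Real.pi / 2) then ⊥ else (Real.tan u : EReal)

theorem tanE_injOn : InjOn tanE (Icc (-(Real.pi / 2)) (Real.pi / 2)) := by
  have hio : ∀ u ∈ Icc (-(Real.pi / 2)) (Real.pi / 2), u ≠ Real.pi / 2 → u ≠ -(Real.pi / 2) →
      u ∈ Ioo (-(Real.pi / 2)) (Real.pi / 2) := fun u hu h1 h2 =>
    ⟨lt_of_le_of_ne hu.1 (Ne.symm h2), lt_of_le_of_ne hu.2 h1⟩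
  intro u hu v hv h
  unfold tanE at h
  split_ifs at h with h1 h2 h3 h4 h5 h6 h7 h8
  all_goals first
    | (subst_vars; rfl)
    | simp at h
  exact Real.injOn_tan (hio u hu ‹_› ‹_›) (hio v hv ‹_› ‹_›) h

theorem tendsto_tanE {y : ℕ → ℝ} {u : ℝ}
    (h : Tendsto (fun n => Real.arctan (y n)) atTop (𝓝 u))
    (hu : u ∈ Icc (-(Real.pi / 2)) (Real.pi / 2)) :
    Tendsto (fun n => (y n : EReal)) atTop (𝓝 (tanE u)) := by
  unfold tanE
  split_ifs with h1 h2
  · rw [EReal.tendsto_nhds_top_iff_real]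
    intro a
    have := Real.arctan_lt_pi_div_two a
    filter_upwards [h.eventually_const_lt (h1 ▸ this)] with n hn
    exact_mod_cast Real.arctan_lt_arctan_iff.1 hn
  · rw [EReal.tendsto_nhds_bot_iff_real]
    intro a
    have := Real.neg_pi_div_two_lt_arctan a
    filter_upwards [h.eventually_lt_const (h2 ▸ this)] with n hn
    exact_mod_cast Real.arctan_lt_arctan_iff.1 hn
  · have hio : u ∈ Ioo (-(Real.pi / 2)) (Real.pi / 2) :=
      ⟨lt_of_le_of_ne hu.1 (Ne.symm h2), lt_of_le_of_ne hu.2 h1⟩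
    have := (Real.continuousOn_tan_Ioo.continuousAt (Ioo_mem_nhds hio.1 hio.2)).tendsto.comp h
    refine (continuous_coe_real_ereal.tendsto _).comp ?_
    simpa [Function.comp_def, Real.tan_arctan] using this

theorem mem_closure_embedE {T : Set (ℝ × ℝ)} (hT : ∀ p ∈ T, p.1 ∈ Icc (0:ℝ) 1) {x u : ℝ}
    (h : (x, u) ∈ arctanClosure T) : (x, tanE u) ∈ closure (embedE '' T) := by
  have hu := (arctanClosure_subset hT h).2
  obtain ⟨q, hq, hlim⟩ := mem_closure_iff_seq_limit.1 h
  choose p hp hpq using hq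
  obtain rfl : q = fun n => ((p n).1, Real.arctan (p n).2) := funext fun n => (hpq n).symm
  rw [Prod.tendsto_iff] at hlim
  have := hlim.1.prodMk_nhds (tendsto_tanE hlim.2 hu)
  exact mem_closure_of_tendsto this (Eventually.of_forall fun n => ⟨p n, hp n, rfl⟩)

theorem gapSet_subset {T : Set (ℝ × ℝ)} (hT : ∀ p ∈ T, p.1 ∈ Icc (0:ℝ) 1) {ε : ℝ}
    (hε : 0 < ε) : gapSet T ε ⊆ {x : ℝ | ∃ y z : EReal,
      (x, y) ∈ closure (embedE '' T) ∧ (x, z) ∈ closure (embedE '' T) ∧ y ≠ z} := by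
  rintro x ⟨u, v, hu, hv, huv⟩
  refine ⟨tanE u, tanE v, mem_closure_embedE hT hu, mem_closure_embedE hT hv, fun h => ?_⟩
  obtain rfl := tanE_injOn (arctanClosure_subset hT hu).2 (arctanClosure_subset hT hv).2 h
  simp at huv
  linarith

/-- If `xⱼ - sⱼ → 0`, then the points `xⱼ` over which `T` has a value far from its value `tⱼ`
over `sⱼ` accumulate only in the gap set. -/
theorem isClosed_gapSet_union {T : Set (ℝ × ℝ)} (hT : ∀ p ∈ T, p.1 ∈ Icc (0:ℝ) 1)
    {x w : ℕ → ℝ} {p : ℕ → ℝ × ℝ} (hp : ∀ j, p j ∈ T) (hw : ∀ j, (x j, w j) ∈ T)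
    (hxp : ∀ j, |x j - (p j).1| < 1 / ((j : ℝ) + 1)) (ε : ℝ) :
    IsClosed (gapSet T ε ∪ x '' {j | ε ≤ |Real.arctan (w j) - Real.arctan (p j).2|}) := by
  set J := {j | ε ≤ |Real.arctan (w j) - Real.arctan (p j).2|}
  rw [← closure_subset_iff_isClosed, closure_union, (isClosed_gapSet hT ε).closure_eq]
  refine union_subset subset_union_left fun z hz => ?_
  by_cases hzJ : z ∈ x '' J
  · exact Or.inr hzJ
  left
  have hfar : ∀ N : ℕ, ∃ j ≥ N, j ∈ J ∧ |x j - z| < 1 / ((N : ℝ) + 1) := by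
    intro N
    have hsplit : x '' J ⊆ x '' (J ∩ Iio N) ∪ x '' (J ∩ Ici N) := by
      rw [← image_union, ← inter_union_distrib_left, Iio_union_Ici, inter_univ]
    have hfin : (x '' (J ∩ Iio N)).Finite := ((finite_Iio N).inter_of_right J).image x
    have h1 := closure_mono hsplit hz
    rw [closure_union, hfin.isClosed.closure_eq] at h1
    have h2 : z ∈ closure (x '' (J ∩ Ici N)) :=
      h1.resolve_left fun h => hzJ (image_mono inter_subset_left h)
    obtain ⟨_, ⟨j, ⟨hj, hjN⟩, rfl⟩, hd⟩ := Metric.mem_closure_iff.1 h2 (1 / ((N : ℝ) + 1))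
      (by positivity)
    rw [dist_comm] at hd
    exact ⟨j, hjN, hj, hd⟩
  choose k hkN hkJ hkz using hfar
  have hK := isCompact_arctanClosure hT
  have hmem : ∀ N, ((x (k N), Real.arctan (w (k N))), ((p (k N)).1, Real.arctan (p (k N)).2)) ∈
      arctanClosure T ×ˢ arctanClosure T := fun N =>
    ⟨mem_arctanClosure (hw _), mem_arctanClosure (hp _)⟩
  obtain ⟨⟨⟨a, u⟩, ⟨b, v⟩⟩, ⟨hu, hv⟩, φ, hφ, hlim⟩ := (hK.prod hK).tendsto_subseq hmem
  simp only [Prod.tendsto_iff, Function.comp_def] at hlim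
  obtain ⟨⟨hla, hlu⟩, hlb, hlv⟩ := hlim
  have hinv := (tendsto_one_div_add_atTop_nhds_zero_nat (𝕜 := ℝ)).comp hφ.tendsto_atTop
  have haz : a = z := by
    refine tendsto_nhds_unique hla (tendsto_iff_dist_tendsto_zero.2 ?_)
    exact squeeze_zero (fun _ => dist_nonneg) (fun N => (hkz (φ N)).le) hinv
  have hab : a - b = 0 := by
    refine tendsto_nhds_unique (hla.sub hlb) (squeeze_zero_norm (fun N => ?_) hinv)
    refine (hxp _).le.trans ?_
    have : (φ N : ℝ) ≤ k (φ N) := by exact_mod_cast hkN (φ N)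
    simp only [Function.comp_def]
    gcongr
  obtain rfl : a = b := by linarith
  subst haz
  exact ⟨u, v, hu, hv, ge_of_tendsto' (hlu.sub hlv).abs fun N => hkJ (φ N)⟩

theorem abs_arctan_sub_le (a b : ℝ) : |Real.arctan a - Real.arctan b| ≤ |a - b| := by
  have h : LipschitzWith 1 Real.arctan := by
    refine lipschitzWith_of_nnnorm_deriv_le Real.differentiable_arctan fun x => ?_
    rw [← NNReal.coe_le_coe, coe_nnnorm, Real.deriv_arctan, Real.norm_eq_abs,
      abs_of_pos (by positivity), NNReal.coe_one, div_le_one (by positivity)]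
    nlinarith [sq_nonneg x]
  simpa [Real.dist_eq] using h.dist_le_mul a b

/-- A function agreeing with a well-covered selection of `T` off a countable set `C` and a
sequence `xⱼ`, where it takes values of `T` at nearby points outside all gap sets, is
Baire 1. -/
theorem baire1_of_eq_selection {T : Set (ℝ × ℝ)} (hT : ∀ p ∈ T, p.1 ∈ Icc (0:ℝ) 1)
    {f₀ f : ℝ → ℝ} (hf₀T : ∀ z, (∃ y, (z, y) ∈ T) → (z, f₀ z) ∈ T)
    (hcov : ∀ ε > 0, SmallOscCover {z | ∃ y, (z, y) ∈ T} f₀ ε)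
    (hC : {z ∈ Icc (0:ℝ) 1 | ∀ y : ℝ, (z, y) ∉ T}.Countable)
    {x : ℕ → ℝ} {p : ℕ → ℝ × ℝ} (hp : ∀ j, p j ∈ T) (hxT : ∀ j, ∃ y, (x j, y) ∈ T)
    (hxp : ∀ j, |x j - (p j).1| < 1 / ((j : ℝ) + 1))
    (hgap : ∀ ε > 0, ∀ j, x j ∉ gapSet T ε) (hfx : ∀ j, f (x j) = (p j).2)
    (hf : ∀ z, (∃ y, (z, y) ∈ T) → z ∉ range x → f z = f₀ z) : Baire1 f := by
  refine Baire1.of_arctan (Baire1.of_smallOscCover fun ε hε => ?_)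
  have hη : 0 < ε / 3 := by positivity
  obtain ⟨F, hFc, hFE, hFo⟩ := hcov (ε / 3) hη
  have hclosed := isClosed_gapSet_union hT hp (fun j => hf₀T _ (hxT j)) hxp (ε / 3)
  set X := x '' {j | ε / 3 ≤ |Real.arctan (f₀ (x j)) - Real.arctan (p j).2|} with hX
  have hFT : ∀ n, ∀ z ∈ F n, ∃ y, (z, y) ∈ T := fun n z hz => by
    have : z ∈ ⋃ n, F n := mem_iUnion.2 ⟨n, hz⟩
    rwa [hFE] at this
  have hnear : ∀ z, (∃ y, (z, y) ∈ T) → z ∉ X →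
      |Real.arctan (f₀ z) - Real.arctan (f z)| ≤ ε / 3 := by
    intro z hz hzX
    by_cases hzx : z ∈ range x
    · obtain ⟨j, rfl⟩ := hzx
      rw [hfx]
      by_contra! h
      exact hzX ⟨j, h.le, rfl⟩
    · rw [hf z hz hzx]
      simpa using hη.le
  have hosc : ∀ n, ∀ z ∈ F n, ∀ w ∈ F n, z ∉ X → w ∉ X →
      |Real.arctan (f z) - Real.arctan (f w)| ≤ ε := by
    intro n z hz w hw hzX hwX
    have h1 := abs_le.1 (hnear z (hFT n z hz) hzX)
    have h2 := abs_le.1 (hnear w (hFT n w hw) hwX)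
    have h3 := abs_le.1 ((abs_arctan_sub_le _ _).trans (hFo n z hz w hw))
    rw [abs_le]
    constructor <;> linarith [h1.1, h1.2, h2.1, h2.2, h3.1, h3.2]
  have hgX : ∀ z ∈ gapSet T (ε / 3), z ∉ X := by
    rintro _ hz ⟨j, -, rfl⟩
    exact hgap _ hη j hz
  set Q := {z ∈ Icc (0:ℝ) 1 | ∀ y : ℝ, (z, y) ∉ T} ∪ range x with hQ
  have : Countable Q := (hC.union (countable_range x)).to_subtype
  refine SmallOscCover.of_locallyClosed (ι := ℕ ⊕ ℕ ⊕ Q)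
    (Sum.elim (fun n => F n ∩ gapSet T (ε / 3)) (Sum.elim F fun q => {(q : ℝ)}))
    (Sum.elim (fun _ => univ) (Sum.elim (fun _ => (gapSet T (ε / 3) ∪ X)ᶜ) fun _ => univ))
    ?_ ?_ ?_ ?_
  · rintro (n | n | q)
    · exact (hFc n).inter (isClosed_gapSet hT _)
    · exact hFc n
    · exact isClosed_singleton
  · rintro (n | n | q)
    · exact isOpen_univ
    · exact hclosed.isOpen_compl
    · exact isOpen_univ
  · apply Subset.antisymm
    · rintro z hz
      obtain ⟨n | n | q, hz1, hz2⟩ := mem_iUnion.1 hz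
      · obtain ⟨y, hy⟩ := hFT n z hz1.1
        exact hT _ hy
      · obtain ⟨y, hy⟩ := hFT n z hz1
        exact hT _ hy
      · obtain rfl : z = q := hz1
        rcases q.2 with h | ⟨j, hj⟩
        · exact h.1
        · obtain ⟨y, hy⟩ := hxT j
          rw [← hj]
          exact hT _ hy
    · intro z hz
      rw [mem_iUnion]
      by_cases hzQ : z ∈ Q
      · exact ⟨.inr (.inr ⟨z, hzQ⟩), rfl, trivial⟩
      rw [hQ, mem_union, not_or] at hzQ
      have hzT : ∃ y, (z, y) ∈ T := by
        by_contra! h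
        exact hzQ.1 ⟨hz, h⟩
      obtain ⟨n, hn⟩ : ∃ n, z ∈ F n := by
        rw [← mem_iUnion, hFE]
        exact hzT
      by_cases hzg : z ∈ gapSet T (ε / 3)
      · exact ⟨.inl n, ⟨hn, hzg⟩, trivial⟩
      · refine ⟨.inr (.inl n), hn, ?_⟩
        rintro (h | ⟨j, -, rfl⟩)
        · exact hzg h
        · exact hzQ.2 ⟨j, rfl⟩
  · rintro (n | n | q) z ⟨hz1, hz2⟩ w ⟨hw1, hw2⟩
    · exact hosc n z hz1.1 w hw1.1 (hgX z hz1.2) (hgX w hw1.2)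
    · exact hosc n z hz1 w hw1 (fun h => hz2 (Or.inr h)) (fun h => hw2 (Or.inr h))
    · obtain rfl : z = q := hz1
      obtain rfl : w = q := hw1
      simpa using hε.le

theorem accPts_subset_of_locally_finite {G T : Set (ℝ × ℝ)}
    (h : ∀ q ∉ T, ∃ U ∈ 𝓝 q, (U ∩ G).Finite) : accPts G ⊆ T := by
  intro q hq
  by_contra hqT
  obtain ⟨U, hU, hfin⟩ := h q hqT
  exact Set.Infinite.of_accPt (AccPt.nhds_inter hq hU) hfin

theorem accPts_graphOn_subset {T : Set (ℝ × ℝ)} (hTc : IsClosed T) {f : ℝ → ℝ} {C : Set ℝ}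
    {ν : ℝ → ℕ} (hν : InjOn ν C) (hfC : ∀ z ∈ C, f z = ν z)
    {x : ℕ → ℝ} {p : ℕ → ℝ × ℝ} (hp : ∀ j, p j ∈ T)
    (hxp : ∀ j, |x j - (p j).1| < 1 / ((j : ℝ) + 1)) (hfx : ∀ j, f (x j) = (p j).2)
    (hf : ∀ z ∈ Icc (0:ℝ) 1, z ∉ C → z ∉ range x → (z, f z) ∈ T) :
    accPts (graphOn (Icc 0 1) f) ⊆ T := by
  refine accPts_subset_of_locally_finite fun q hq => ?_
  obtain ⟨r, hr, hball⟩ := Metric.isOpen_iff.1 hTc.isOpen_compl q hq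
  have hJ : {j : ℕ | r / 2 ≤ 1 / ((j : ℝ) + 1)}.Finite := by
    obtain ⟨N, hN⟩ := exists_nat_gt (2 / r)
    refine (finite_Iic N).subset fun j hj => ?_
    have hj' : r / 2 ≤ 1 / ((j : ℝ) + 1) := hj
    rw [le_div_iff₀ (by positivity)] at hj'
    rw [div_lt_iff₀ hr] at hN
    have : (j : ℝ) ≤ N := by
      by_contra! h
      nlinarith
    exact_mod_cast this
  have hN : (C ∩ {z | (ν z : ℝ) ≤ q.2 + r / 2}).Finite := by
    obtain ⟨N, hN⟩ := exists_nat_ge (q.2 + r / 2)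
    refine Finite.of_finite_image ((finite_Iic N).subset ?_) (hν.mono inter_subset_left)
    rintro _ ⟨z, ⟨-, hz⟩, rfl⟩
    exact_mod_cast (show (ν z : ℝ) ≤ _ from hz).trans hN
  refine ⟨ball q (r / 2), ball_mem_nhds _ (by positivity),
    (((hJ.image x).union hN).image fun z => (z, f z)).subset ?_⟩
  rintro ⟨z, w⟩ ⟨hzb, hz, hw⟩
  obtain rfl : w = f z := hw
  refine ⟨z, ?_, rfl⟩
  by_cases hzC : z ∈ C
  · refine Or.inr ⟨hzC, ?_⟩
    have h1 : |f z - q.2| < r / 2 := (le_max_right _ _).trans_lt hzb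
    rw [hfC z hzC] at h1
    change (ν z : ℝ) ≤ _
    linarith [(abs_lt.1 h1).2]
  by_cases hzx : z ∈ range x
  · obtain ⟨j, rfl⟩ := hzx
    refine Or.inl ⟨j, ?_, rfl⟩
    by_contra h
    have h' : 1 / ((j : ℝ) + 1) < r / 2 := not_le.1 h
    refine hball ?_ (hp j)
    have h1 : dist (p j) (x j, f (x j)) < r / 2 := by
      rw [Prod.dist_eq, hfx, dist_self, dist_comm]
      exact max_lt ((hxp j).trans h') (by positivity)
    calc dist (p j) q ≤ dist (p j) (x j, f (x j)) + dist (x j, f (x j)) q := dist_triangle _ _ _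
      _ < r / 2 + r / 2 := add_lt_add h1 hzb
      _ = r := by ring
  · exact absurd (hf z hz hzC hzx) (hball (ball_subset_ball (by linarith) hzb))

theorem subset_accPts_graphOn {T : Set (ℝ × ℝ)} {f : ℝ → ℝ} {d : ℕ → T} (hd : DenseRange d)
    {x : ℕ → ℝ} (hx : ∀ j, x j ∈ Icc (0:ℝ) 1) (hne : ∀ j, x j ≠ (d j.unpair.1 : ℝ × ℝ).1)
    (hxd : ∀ j, |x j - (d j.unpair.1 : ℝ × ℝ).1| < 1 / ((j : ℝ) + 1))
    (hfx : ∀ j, f (x j) = (d j.unpair.1 : ℝ × ℝ).2) : T ⊆ accPts (graphOn (Icc 0 1) f) := by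
  have hclosed : IsClosed (accPts (graphOn (Icc 0 1) f)) := isClosed_derivedSet _
  have hmem : ∀ i, (d i : ℝ × ℝ) ∈ accPts (graphOn (Icc 0 1) f) := by
    intro i
    refine accPt_iff_frequently.2 (Metric.nhds_basis_ball.frequently_iff.2 fun r hr => ?_)
    obtain ⟨N, hN⟩ := exists_nat_one_div_lt hr
    have hj := hxd (Nat.pair i N)
    have hjne := hne (Nat.pair i N)
    have hjf := hfx (Nat.pair i N)
    simp only [Nat.unpair_pair] at hj hjne hjf
    refine ⟨(x (Nat.pair i N), f (x (Nat.pair i N))), ?_, fun h => hjne (congrArg Prod.fst h),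
      hx _, rfl⟩
    rw [Metric.mem_ball, Prod.dist_eq, hjf, dist_self]
    refine max_lt (hj.trans (lt_of_le_of_lt ?_ hN)) hr
    have : (N : ℝ) ≤ (Nat.pair i N : ℕ) := by exact_mod_cast Nat.right_le_pair i N
    gcongr
  intro q hq
  have h1 : (⟨q, hq⟩ : T) ∈ closure (range d) := hd _
  have h2 : closure (range d) ⊆ Subtype.val ⁻¹' accPts (graphOn (Icc 0 1) f) :=
    closure_minimal (range_subset_iff.2 hmem) (hclosed.preimage continuous_subtype_val)
  exact h2 h1

theorem stmt19 (T : Set (ℝ × ℝ)) (hT : ∀ p ∈ T, p.1 ∈ Icc (0:ℝ) 1)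
    (hTc : IsClosed T)
    (hC : {x ∈ Icc (0:ℝ) 1 | ∀ y : ℝ, (x, y) ∉ T}.Countable)
    (hD : MeagreIn01 {x : ℝ | ∃ y z : EReal,
      (x, y) ∈ closure (embedE '' T) ∧ (x, z) ∈ closure (embedE '' T) ∧ y ≠ z}) :
    ∃ f : ℝ → ℝ, Baire1 f ∧ accPts (graphOn (Icc 0 1) f) = T ∧
      closure (embedE '' accPts (graphOn (Icc 0 1) f)) = closure (embedE '' T) := by
  classical
  suffices h : ∃ f : ℝ → ℝ, Baire1 f ∧ accPts (graphOn (Icc 0 1) f) = T by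
    obtain ⟨f, hf, hfT⟩ := h
    exact ⟨f, hf, hfT, by rw [hfT]⟩
  set C := {x ∈ Icc (0:ℝ) 1 | ∀ y : ℝ, (x, y) ∉ T} with hCdef
  have hTC : ∀ z ∈ Icc (0:ℝ) 1, z ∉ C → ∃ y, (z, y) ∈ T := fun z hz hzC => by
    by_contra! h
    exact hzC ⟨hz, h⟩
  obtain ⟨f₀, hf₀T, hcov⟩ := exists_selection_s19 hT hTc
  have : Nonempty T := by
    by_contra h
    have hCI : C = Icc 0 1 :=
      Subset.antisymm (fun z hz => hz.1) fun z hz => ⟨hz, fun y hy => h ⟨⟨_, hy⟩⟩⟩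
    rw [hCI, Cardinal.Real.Icc_countable_iff] at hC
    norm_num at hC
  obtain ⟨d, hd⟩ := TopologicalSpace.exists_dense_seq T
  obtain ⟨x, hinj, hx⟩ := hD.exists_injective_seq hC
    (s := fun j => (d j.unpair.1 : ℝ × ℝ).1) fun j => hT _ (d _).2
  choose hx01 hxD hxC hxne hxd using hx
  obtain ⟨ν, hν⟩ := countable_iff_exists_injOn.1 hC
  let f : ℝ → ℝ := fun z => if h : ∃ j, x j = z then (d h.choose.unpair.1 : ℝ × ℝ).2
    else if z ∈ C then ν z else f₀ z
  have hfx : ∀ j, f (x j) = (d j.unpair.1 : ℝ × ℝ).2 := fun j => by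
    have h : ∃ i, x i = x j := ⟨j, rfl⟩
    simp only [f, dif_pos h, hinj h.choose_spec]
  have hfC : ∀ z ∈ C, f z = ν z := fun z hz => by
    have h : ¬∃ j, x j = z := by
      rintro ⟨j, rfl⟩
      exact hxC j hz
    simp only [f, dif_neg h, if_pos hz]
  have hff₀ : ∀ z ∉ C, z ∉ range x → f z = f₀ z := fun z hz hzx => by
    have h : ¬∃ j, x j = z := hzx
    simp only [f, dif_neg h, if_neg hz]
  refine ⟨f, ?_, Subset.antisymm ?_ (subset_accPts_graphOn hd hx01 hxne hxd hfx)⟩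
  · exact baire1_of_eq_selection hT hf₀T hcov hC (fun j => (d j.unpair.1).2)
      (fun j => hTC _ (hx01 j) (hxC j)) hxd (fun ε hε j h => hxD j (gapSet_subset hT hε h)) hfx
      fun z ⟨y, hy⟩ => hff₀ z fun hz => hz.2 y hy
  · refine accPts_graphOn_subset hTc hν hfC (fun j => (d j.unpair.1).2) hxd hfx
      fun z hz hzC hzx => ?_
    rw [hff₀ z hzC hzx]
    exact hf₀T z (hTC z hz hzC)
end
end
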